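/- For distinct ballot sequences α, the elements Δ_{C(α)} are linearly independent in the exterior algebra: the set {Δ_{C(α)} : α a ballot sequence of length n} has cardinality C(n, ⌊n/2⌋) and is Q-linearly independent. -/

import Mathlib

open ExteriorAlgebra

attribute [local instance] Classical.propDecidable

/-- The generator `θ_i` of the exterior algebra `Λ(ℚ^n)`. -/
noncomputable def theta (n : ℕ) (i : Fin n) : ExteriorAlgebra ℚ (Fin n → ℚ) :=
  ExteriorAlgebra.ι ℚ (Pi.single i (1 : ℚ))

/-- `α ∈ {0,1}^n` is a ballot sequence: every prefix of length `r` has at most `r/2` ones. -/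
def IsBallot {n : ℕ} (α : Fin n → Bool) : Prop :=
  ∀ r : ℕ, r ≤ n →
    2 * (Finset.univ.filter (fun i : Fin n => (i : ℕ) < r ∧ α i = true)).card ≤ r

/-- The "depth" of the parenthesis sequence of `α` after `r` symbols:
(number of `0`s, i.e. open parens) − (number of `1`s, i.e. close parens) among the
first `r` entries. -/
def depth {n : ℕ} (α : Fin n → Bool) (r : ℕ) : ℤ :=
  ((Finset.univ.filter (fun i : Fin n => (i : ℕ) < r ∧ α i = false)).card : ℤ) -
  ((Finset.univ.filter (fun i : Fin n => (i : ℕ) < r ∧ α i = true)).card : ℤ)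

/-- Position `i` (an open paren, `0`) is matched with position `j` (a close paren, `1`)
in the natural maximal pairing of parentheses: the depth returns at `j+1` to its value
before `i`, staying strictly above in between. -/
def IsMatch {n : ℕ} (α : Fin n → Bool) (i j : Fin n) : Prop :=
  i < j ∧ α i = false ∧ α j = true ∧
    depth α ((j : ℕ) + 1) = depth α i ∧
    ∀ t : ℕ, (i : ℕ) < t → t ≤ (j : ℕ) → depth α i < depth α t

/-- `Δ_{C(α)} = Π_r (θ_{j_r} - θ_{i_r})` where `(i_r, j_r)` are the matched pairs of
`α`, the product taken with `j_1 < j_2 < ⋯ < j_k` (the positions of the `1`s). -/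
noncomputable def DeltaBallot {n : ℕ} (μ : (Fin n → Bool) → Fin n → Fin n)
    (α : Fin n → Bool) : ExteriorAlgebra ℚ (Fin n → ℚ) :=
  (((Finset.univ.filter (fun j : Fin n => α j = true)).sort (· ≤ ·)).map
    (fun j => theta n j - theta n (μ α j))).prod

/-- The functional extracting the coefficient of `θ_J`. -/
noncomputable def coeffFun (n : ℕ) (J : Finset (Fin n)) :
    ExteriorAlgebra ℚ (Fin n → ℚ) →ₗ[ℚ] ℚ :=
  ExteriorAlgebra.liftAlternating (R := ℚ) (fun i =>
    if h : J.card = i then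
      (Matrix.detRowAlternating (R := ℚ) (n := Fin i)).compLinearMap
        (LinearMap.funLeft ℚ ℚ (J.orderEmbOfFin h))
    else 0)

theorem prod_eq_multi (n : ℕ) (J : Finset (Fin n)) (m : Fin n → Fin n) :
    ((J.sort (· ≤ ·)).map (fun j => theta n j - theta n (m j))).prod =
      ExteriorAlgebra.ιMulti ℚ J.card (fun a => Pi.single (J.orderEmbOfFin rfl a) (1 : ℚ) -
        Pi.single (m (J.orderEmbOfFin rfl a)) (1 : ℚ)) := by
  rw [ExteriorAlgebra.ιMulti_apply, ← Finset.listMap_orderEmbOfFin_finRange J rfl,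
    List.map_map, List.ofFn_eq_map]
  congr 2
  funext a
  simp [theta]

theorem coeffFun_ne_card (n : ℕ) (J K : Finset (Fin n)) (m : Fin n → Fin n)
    (h : K.card ≠ J.card) :
    coeffFun n K ((J.sort (· ≤ ·)).map (fun j => theta n j - theta n (m j))).prod = 0 := by
  rw [prod_eq_multi, coeffFun, ExteriorAlgebra.liftAlternating_apply_ιMulti, dif_neg h]
  rfl

theorem coeffFun_eq_det (n : ℕ) (J K : Finset (Fin n)) (m : Fin n → Fin n)
    (h : K.card = J.card) :
    coeffFun n K ((J.sort (· ≤ ·)).map (fun j => theta n j - theta n (m j))).prod =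
      (Matrix.of (fun a b : Fin J.card =>
        (Pi.single (J.orderEmbOfFin rfl a) (1 : ℚ) : Fin n → ℚ) (K.orderEmbOfFin h b) -
        (Pi.single (m (J.orderEmbOfFin rfl a)) (1 : ℚ) : Fin n → ℚ)
          (K.orderEmbOfFin h b))).det := by
  rw [prod_eq_multi, coeffFun, ExteriorAlgebra.liftAlternating_apply_ιMulti, dif_pos h]
  rfl

theorem coeffFun_self (n : ℕ) (J : Finset (Fin n)) (m : Fin n → Fin n)
    (hm : ∀ j ∈ J, m j < j) :
    coeffFun n J ((J.sort (· ≤ ·)).map (fun j => theta n j - theta n (m j))).prod = 1 := by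
  rw [coeffFun_eq_det n J J m rfl, Matrix.det_of_isLowerTriangular]
  · apply Finset.prod_eq_one
    intro a _
    have := hm _ (J.orderEmbOfFin_mem rfl a)
    simp [Pi.single_apply, this.ne']
  · intro a b hab
    have hab' : a < b := hab
    have h1 : J.orderEmbOfFin rfl a < J.orderEmbOfFin rfl b := by simpa using hab'
    have h2 := hm _ (J.orderEmbOfFin_mem rfl a)
    simp only [Matrix.of_apply, Pi.single_apply]
    rw [if_neg h1.ne', if_neg (h2.trans h1).ne', sub_zero]

theorem sum_orderEmb (n : ℕ) (J : Finset (Fin n)) {k : ℕ} (h : J.card = k) :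
    ∑ a, ((J.orderEmbOfFin h a : Fin n) : ℕ) = ∑ j ∈ J, (j : ℕ) := by
  conv_rhs => rw [← Finset.map_orderEmbOfFin_univ J h]
  rw [Finset.sum_map]
  rfl

theorem coeffFun_lt (n : ℕ) (J K : Finset (Fin n)) (m : Fin n → Fin n)
    (hm : ∀ j ∈ J, m j < j) (hne : K ≠ J)
    (h0 : coeffFun n K ((J.sort (· ≤ ·)).map (fun j => theta n j - theta n (m j))).prod ≠ 0) :
    ∑ j ∈ K, (j : ℕ) < ∑ j ∈ J, (j : ℕ) := by
  by_cases h : K.card = J.card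
  swap
  · exact absurd (coeffFun_ne_card n J K m h) h0
  rw [coeffFun_eq_det n J K m h, Matrix.det_apply] at h0
  obtain ⟨σ, -, hσ⟩ := Finset.exists_ne_zero_of_sum_ne_zero h0
  have hp : ∀ a, K.orderEmbOfFin h a = J.orderEmbOfFin rfl (σ a) ∨
      K.orderEmbOfFin h a = m (J.orderEmbOfFin rfl (σ a)) := by
    intro a
    by_contra hc
    push Not at hc
    apply hσ
    rw [Finset.prod_eq_zero (Finset.mem_univ a), smul_zero]
    simp [Pi.single_apply, hc.1, hc.2]
  have hle : ∀ a, K.orderEmbOfFin h a ≤ J.orderEmbOfFin rfl (σ a) := by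
    intro a
    rcases hp a with h1 | h1
    · exact h1.le
    · rw [h1]; exact (hm _ (J.orderEmbOfFin_mem rfl _)).le
  rw [← sum_orderEmb n K h, ← sum_orderEmb n J rfl,
    ← Equiv.sum_comp σ (fun a => ((J.orderEmbOfFin rfl a : Fin n) : ℕ))]
  apply Finset.sum_lt_sum
  · intro a _
    exact hle a
  · by_contra hc
    push Not at hc
    apply hne
    apply Finset.eq_of_subset_of_card_le _ h.ge
    intro x hx
    rw [← Finset.image_orderEmbOfFin_univ K h] at hx
    obtain ⟨a, -, rfl⟩ := Finset.mem_image.1 hx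
    have : K.orderEmbOfFin h a = J.orderEmbOfFin rfl (σ a) :=
      le_antisymm (hle a) (hc a (Finset.mem_univ a))
    rw [this]
    exact J.orderEmbOfFin_mem rfl _

/-- Triangularity implies linear independence. -/
theorem linInd_of_triangular {I V : Type*} [AddCommGroup V] [Module ℚ V]
    (v : I → V) (φ : I → V →ₗ[ℚ] ℚ) (w : I → ℕ) (h1 : ∀ i, φ i (v i) = 1)
    (h2 : ∀ i j, i ≠ j → φ i (v j) ≠ 0 → w i < w j) : LinearIndependent ℚ v := by
  rw [linearIndependent_iff']
  intro s g hg i hi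
  by_contra hne
  obtain ⟨a, ha, hmax⟩ := Finset.exists_max_image (s.filter (fun i => g i ≠ 0)) w
    ⟨i, Finset.mem_filter.2 ⟨hi, hne⟩⟩
  rw [Finset.mem_filter] at ha
  have := congrArg (φ a) hg
  rw [map_sum, map_zero, Finset.sum_eq_single a] at this
  · rw [map_smul, h1] at this
    simp at this
    exact ha.2 this
  · intro b hb hba
    by_contra hc
    rw [map_smul, smul_eq_mul] at hc
    have hb' := hmax b (Finset.mem_filter.2 ⟨hb, left_ne_zero_of_mul hc⟩)
    have := h2 a b hba.symm (right_ne_zero_of_mul hc)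
    omega
  · exact fun h => absurd ha.1 h

/-- number of ones among the first `r` entries -/
noncomputable def onesBefore {n : ℕ} (α : Fin n → Bool) (r : ℕ) : ℕ :=
  (Finset.univ.filter (fun i : Fin n => (i : ℕ) < r ∧ α i = true)).card

abbrev snocB {n : ℕ} (α : Fin n → Bool) (b : Bool) : Fin (n + 1) → Bool :=
  Fin.snoc (α := fun _ => Bool) α b

theorem onesBefore_snoc_le {n : ℕ} (α : Fin n → Bool) (b : Bool) (r : ℕ) (hr : r ≤ n) :
    onesBefore (snocB α b) r = onesBefore α r := by
  simp only [onesBefore, Finset.card_filter, Fin.sum_univ_castSucc, Fin.snoc_castSucc,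
    Fin.val_castSucc, Fin.val_last, snocB, Fin.snoc_last]
  rw [if_neg (by omega : ¬ (n < r ∧ b = true)), add_zero]

theorem onesBefore_snoc_last {n : ℕ} (α : Fin n → Bool) (b : Bool) :
    onesBefore (snocB α b) (n + 1) = onesBefore α n + b.toNat := by
  simp only [onesBefore, Finset.card_filter, Fin.sum_univ_castSucc, Fin.snoc_castSucc,
    Fin.val_castSucc, Fin.val_last, snocB, Fin.snoc_last]
  congr 1
  · apply Finset.sum_congr rfl
    intro i _
    have := i.2
    have h2 : (i : ℕ) < n + 1 := by omega
    simp [h2]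
  · cases b <;> simp

theorem isBallot_snoc {n : ℕ} (α : Fin n → Bool) (b : Bool) :
    IsBallot (snocB α b) ↔ IsBallot α ∧ 2 * (onesBefore α n + b.toNat) ≤ n + 1 := by
  constructor
  · intro h
    refine ⟨fun r hr => ?_, ?_⟩
    · have := h r (by omega)
      change 2 * onesBefore _ r ≤ r at this
      rwa [onesBefore_snoc_le α b r hr] at this
    · rw [← onesBefore_snoc_last]
      exact h (n + 1) le_rfl
  · rintro ⟨h1, h2⟩ r hr
    change 2 * onesBefore _ r ≤ r
    rcases Nat.lt_or_ge n r with h | h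
    · obtain rfl : r = n + 1 := by omega
      rwa [onesBefore_snoc_last]
    · rw [onesBefore_snoc_le α b r h]
      exact h1 r h

noncomputable def ballotSet (n k : ℕ) : Finset (Fin n → Bool) :=
  Finset.univ.filter (fun α => IsBallot α ∧ onesBefore α n ≤ k)

theorem ballotSet_succ (n k : ℕ) (hk : 2 * (k + 1) ≤ n + 1) :
    (ballotSet (n + 1) (k + 1)).card = (ballotSet n (k + 1)).card + (ballotSet n k).card := by
  have hi : ∀ b : Bool, Function.Injective (fun α : Fin n → Bool => snocB α b) :=
    fun b => Fin.snoc_left_injective (α := fun _ => Bool) b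
  have : ballotSet (n + 1) (k + 1) =
      (ballotSet n (k + 1)).image (fun α => snocB α false) ∪
      (ballotSet n k).image (fun α => snocB α true) := by
    ext β
    obtain ⟨α, b, rfl⟩ : ∃ α b, β = snocB α b :=
      ⟨Fin.init β, β (Fin.last n), (Fin.snoc_init_self (α := fun _ => Bool) β).symm⟩
    simp only [ballotSet, Finset.mem_union, Finset.mem_image, Finset.mem_filter,
      Finset.mem_univ, true_and, Fin.snoc_inj, snocB]
    change (IsBallot (snocB α b) ∧ onesBefore (snocB α b) (n + 1) ≤ k + 1) ↔ _
    rw [isBallot_snoc, onesBefore_snoc_last]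
    cases b
    · simp only [Bool.toNat_false, add_zero]
      constructor
      · rintro ⟨⟨h1, h2⟩, h3⟩
        exact Or.inl ⟨α, ⟨h1, h3⟩, rfl, trivial⟩
      · rintro (⟨α', ⟨h1, h3⟩, rfl, -⟩ | ⟨α', _, _, h⟩)
        · exact ⟨⟨h1, by omega⟩, h3⟩
        · simp at h
    · simp only [Bool.toNat_true]
      constructor
      · rintro ⟨⟨h1, h2⟩, h3⟩
        exact Or.inr ⟨α, ⟨h1, by omega⟩, rfl, trivial⟩
      · rintro (⟨α', _, _, h⟩ | ⟨α', ⟨h1, h3⟩, rfl, -⟩)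
        · simp at h
        · exact ⟨⟨h1, by omega⟩, by omega⟩
  rw [this, Finset.card_union_of_disjoint, Finset.card_image_of_injective _ (hi _),
    Finset.card_image_of_injective _ (hi _)]
  rw [Finset.disjoint_left]
  intro x hx hy
  obtain ⟨a, -, rfl⟩ := Finset.mem_image.1 hx
  obtain ⟨c, -, h⟩ := Finset.mem_image.1 hy
  have := congrFun h (Fin.last n)
  simp [snocB] at this

theorem ballotSet_zero (n : ℕ) : (ballotSet n 0).card = 1 := by
  rw [Finset.card_eq_one]
  refine ⟨fun _ => false, ?_⟩
  ext α
  simp only [ballotSet, Finset.mem_filter, Finset.mem_univ, true_and, Finset.mem_singleton]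
  constructor
  · rintro ⟨-, h⟩
    funext i
    rw [Nat.le_zero, onesBefore, Finset.card_eq_zero, Finset.filter_eq_empty_iff] at h
    have := h (Finset.mem_univ i)
    simpa using this
  · rintro rfl
    constructor
    · intro r _
      simp
    · simp [onesBefore]

theorem card_ballotSet (n : ℕ) : ∀ k, 2 * k ≤ n → (ballotSet n k).card = n.choose k := by
  induction n with
  | zero =>
    intro k hk
    obtain rfl : k = 0 := by omega
    simp [ballotSet_zero]
  | succ n ih =>
    intro k hk
    rcases k with _ | k
    · simp [ballotSet_zero]
    · rw [ballotSet_succ n k hk, Nat.choose_succ_succ, ih k (by omega), add_comm]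
      congr 1
      rcases Nat.lt_or_ge n (2 * (k + 1)) with h | h
      · have h3 : n = 2 * k + 1 := by omega
        have : ballotSet n (k + 1) = ballotSet n k := by
          ext α
          simp only [ballotSet, Finset.mem_filter, Finset.mem_univ, true_and]
          constructor
          · rintro ⟨h1, h2⟩
            have h4 : 2 * onesBefore α n ≤ n := h1 n le_rfl
            exact ⟨h1, by omega⟩
          · rintro ⟨h1, h2⟩
            exact ⟨h1, by omega⟩
        rw [this, ih k (by omega), h3]
        exact (Nat.choose_symm_half k).symm
      · exact ih (k + 1) h

/-- For any matching function `μ` realizing the parenthesis matching `C(α)` of each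
ballot sequence `α`, the family `{Δ_{C(α)} : α ballot}` is `ℚ`-linearly independent and
has cardinality `C(n, ⌊n/2⌋)`. -/
theorem stmt14 (n : ℕ) (μ : (Fin n → Bool) → Fin n → Fin n)
    (hμ : ∀ α : Fin n → Bool, IsBallot α → ∀ j : Fin n, α j = true →
      IsMatch α (μ α j) j) :
    LinearIndependent ℚ (fun α : {α : Fin n → Bool // IsBallot α} =>
      DeltaBallot μ α.1) ∧
    Fintype.card {α : Fin n → Bool // IsBallot α} = n.choose (n / 2) := by
  constructor
  · apply linInd_of_triangular _
      (fun α => coeffFun n (Finset.univ.filter (fun j : Fin n => α.1 j = true)))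
      (fun α => ∑ j ∈ Finset.univ.filter (fun j : Fin n => α.1 j = true), (j : ℕ))
    · intro α
      exact coeffFun_self n _ (μ α.1)
        (fun j hj => (hμ α.1 α.2 j (Finset.mem_filter.1 hj).2).1)
    · intro α β hne h0
      refine coeffFun_lt n _ _ (μ β.1)
        (fun j hj => (hμ β.1 β.2 j (Finset.mem_filter.1 hj).2).1) ?_ h0
      intro h
      apply hne
      apply Subtype.ext
      funext j
      have := Finset.ext_iff.1 h j
      simp only [Finset.mem_filter, Finset.mem_univ, true_and] at this
      exact Bool.eq_iff_iff.2 this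
  · rw [← card_ballotSet n (n / 2) (by omega), Fintype.card_subtype]
    congr 1
    ext α
    simp only [ballotSet, Finset.mem_filter, Finset.mem_univ, true_and]
    constructor
    · intro h
      have h4 : 2 * onesBefore α n ≤ n := h n le_rfl
      exact ⟨h, by omega⟩
    · exact fun h => h.1
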